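/- arXiv:2006.12311 — 2 statements merged into one kernel-verified Lean document; each statement's English description precedes it below -/
import Mathlib

section
/- Fix positive integers d and a nonempty set X, a nonempty set A, a function ψ : X × A → ℝ^d with ‖ψ(x,a)‖₂ ≤ 1 for all (x,a), and constants λ > 0, L > 0, B ≥ 0, a fixed β ∈ [0, B], and reals H, h with H − h ≥ 0. Let 𝒬 be the class of all functions Q : X × A → ℝ of the form Q(x,a) = min{ ψ(x,a)ᵀ ω + √2 β · (log det(Λ + ψ(x,a) ψ(x,a)ᵀ) − log det(Λ))^{1/2}, H − h }, ranging over parameters ω ∈ ℝ^d with ‖ω‖₂ ≤ L and symmetric positive definite Λ ∈ ℝ^{d×d} with Λ ⪰ λI. Then for every ε > 0 there exists a finite set 𝒩 of functions from X × A to ℝ such that every Q ∈ 𝒬 satisfies sup_{(x,a)∈X×A} |Q(x,a) − Q̃(x,a)| ≤ ε for some Q̃ ∈ 𝒩, and log |𝒩| ≤ d · log(1 + 4L/ε) + d² · log(1 + 16 B² d^{1/2} / (ε² λ)). -/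
open Matrix

section helpers
open MeasureTheory Metric Module

theorem aux_card {E : Type*} [NormedAddCommGroup E] [NormedSpace ℝ E] [FiniteDimensional ℝ E]
    (R δ' : ℝ) (hR : 0 ≤ R) (hδ' : 0 < δ') (s : Finset E) (hs : ∀ c ∈ s, ‖c‖ ≤ R)
    (h : ∀ c ∈ s, ∀ d ∈ s, c ≠ d → δ' ≤ ‖c - d‖) :
    (s.card : ℝ) ≤ (1 + 2 * R / δ') ^ finrank ℝ E := by
  borelize E
  let μ : Measure E := Measure.addHaar
  obtain ⟨δ, hδ⟩ : ∃ δ : ℝ, δ = δ' / 2 := ⟨_, rfl⟩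
  obtain ⟨ρ, hρ⟩ : ∃ ρ : ℝ, ρ = R + δ' / 2 := ⟨_, rfl⟩
  have ρpos : 0 < ρ := by rw [hρ]; positivity
  have δpos : 0 < δ := by rw [hδ]; positivity
  set A := ⋃ c ∈ s, ball (c : E) δ with hA
  have D : Set.Pairwise (s : Set E) (Function.onFun Disjoint fun c => ball (c : E) δ) := by
    rintro c hc d hd hcd
    apply ball_disjoint_ball
    rw [dist_eq_norm]
    have := h c hc d hd hcd
    linarith
  have A_subset : A ⊆ ball (0 : E) ρ := by
    refine Set.iUnion₂_subset fun x hx => ?_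
    apply ball_subset_ball'
    rw [dist_zero_right]
    have := hs x hx
    linarith
  have I :
    (s.card : ENNReal) * ENNReal.ofReal (δ ^ finrank ℝ E) * μ (ball 0 1) ≤
      ENNReal.ofReal (ρ ^ finrank ℝ E) * μ (ball 0 1) :=
    calc
      (s.card : ENNReal) * ENNReal.ofReal (δ ^ finrank ℝ E) * μ (ball 0 1) = μ A := by
        rw [hA, measure_biUnion_finset D fun c _ => measurableSet_ball]
        simp only [μ.addHaar_ball_of_pos _ δpos]
        simp only [Finset.sum_const, nsmul_eq_mul, mul_assoc]
      _ ≤ μ (ball (0 : E) ρ) := measure_mono A_subset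
      _ = ENNReal.ofReal (ρ ^ finrank ℝ E) * μ (ball 0 1) := by
        simp only [μ.addHaar_ball_of_pos _ ρpos]
  have J : (s.card : ENNReal) * ENNReal.ofReal (δ ^ finrank ℝ E) ≤
      ENNReal.ofReal (ρ ^ finrank ℝ E) :=
    (ENNReal.mul_le_mul_iff_left (measure_ball_pos _ _ zero_lt_one).ne' measure_ball_lt_top.ne).1 I
  have K := ENNReal.toReal_le_of_le_ofReal (pow_nonneg ρpos.le _) J
  rw [ENNReal.toReal_mul, ENNReal.toReal_natCast, ENNReal.toReal_ofReal (by positivity)] at K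
  have e : 1 + 2 * R / δ' = ρ / δ := by
    rw [hρ, hδ]; field_simp; ring
  rw [e, div_pow, le_div_iff₀ (by positivity)]
  exact K

theorem aux_net {E : Type*} [NormedAddCommGroup E] [NormedSpace ℝ E] [FiniteDimensional ℝ E]
    (R δ : ℝ) (hR : 0 ≤ R) (hδ : 0 < δ) (S : Set E) (hS : ∀ c ∈ S, ‖c‖ ≤ R) :
    ∃ N : Finset E, (∀ c ∈ N, c ∈ S) ∧ (∀ v ∈ S, ∃ w ∈ N, ‖v - w‖ ≤ δ) ∧
      (N.card : ℝ) ≤ (1 + 2 * R / δ) ^ finrank ℝ E := by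
  classical
  let P : ℕ → Prop := fun n => ∃ s : Finset E, (∀ c ∈ s, c ∈ S) ∧
    (∀ c ∈ s, ∀ d ∈ s, c ≠ d → δ ≤ ‖c - d‖) ∧ s.card = n
  obtain ⟨K, hK⟩ := exists_nat_ge ((1 + 2 * R / δ) ^ finrank ℝ E)
  have bd : ∀ n, P n → n ≤ K := by
    rintro n ⟨s, h1, h2, rfl⟩
    exact_mod_cast (aux_card R δ hR hδ s (fun c hc => hS c (h1 c hc)) h2).trans hK
  have P0 : P 0 := ⟨∅, by simp, by simp, by simp⟩
  obtain ⟨s, h1, h2, h3⟩ := Nat.findGreatest_spec (P := P) (Nat.zero_le K) P0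
  refine ⟨s, h1, ?_, aux_card R δ hR hδ s (fun c hc => hS c (h1 c hc)) h2⟩
  intro v hv
  by_contra! hcon
  have hvs : v ∉ s := fun hv' => by
    have := hcon v hv'
    simp at this
    linarith
  have : P (s.card + 1) := by
    refine ⟨insert v s, ?_, ?_, Finset.card_insert_of_notMem hvs⟩
    · intro c hc
      rcases Finset.mem_insert.1 hc with rfl | hc
      · exact hv
      · exact h1 c hc
    · intro c hc d hd hcd
      rcases Finset.mem_insert.1 hc with rfl | hc' <;> rcases Finset.mem_insert.1 hd with rfl | hd'
      · exact absurd rfl hcd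
      · exact (hcon d hd').le
      · rw [norm_sub_rev]; exact (hcon c hc').le
      · exact h2 c hc' d hd' hcd
  have := Nat.le_findGreatest (bd _ this) this
  omega

theorem aux_inv (d : ℕ) (lam : ℝ) (hlam : 0 < lam) (Λ : Matrix (Fin d) (Fin d) ℝ)
    (hΛ : Λ.PosDef) (h : (Λ - lam • (1 : Matrix (Fin d) (Fin d) ℝ)).PosSemidef) :
    ∑ ij : Fin d × Fin d, (Λ⁻¹ ij.1 ij.2) ^ 2 ≤ d / lam ^ 2 := by
  rw [Fintype.sum_prod_type_right]
  have key : ∀ j, ∑ i, (Λ⁻¹ i j) ^ 2 ≤ 1 / lam ^ 2 := by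
    intro j
    set v : Fin d → ℝ := fun i => Λ⁻¹ i j with hv
    have h1 := h.dotProduct_mulVec_nonneg v
    have h2 : Λ *ᵥ v = Pi.single j 1 := by
      have : v = Λ⁻¹ *ᵥ Pi.single j 1 := by
        ext i; simp [hv]
      rw [this, mulVec_mulVec, mul_nonsing_inv _ ((isUnit_iff_isUnit_det _).1 hΛ.isUnit),
        one_mulVec]
    rw [sub_mulVec, h2, smul_mulVec, one_mulVec] at h1
    have h3 : lam * ∑ i, v i ^ 2 ≤ v j := by
      simp [dotProduct_sub, dotProduct_smul] at h1
      simpa [dotProduct, pow_two] using h1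
    have h4 : v j ^ 2 ≤ ∑ i, v i ^ 2 :=
      Finset.single_le_sum (f := fun i => v i ^ 2) (fun i _ => sq_nonneg _) (Finset.mem_univ j)
    have h5 : 0 ≤ ∑ i, v i ^ 2 := Finset.sum_nonneg fun i _ => sq_nonneg _
    change ∑ i, v i ^ 2 ≤ _
    set s := ∑ i, v i ^ 2
    rw [le_div_iff₀ (by positivity)]
    by_contra! hc
    have h6 : (lam * s) ^ 2 ≤ v j ^ 2 := pow_le_pow_left₀ (by positivity) h3 2
    have h7 : 0 < s := by
      rcases h5.eq_or_lt with h0 | h0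
      · rw [← h0] at hc; simp at hc; linarith
      · exact h0
    nlinarith
  calc _ ≤ ∑ j : Fin d, 1 / lam ^ 2 := Finset.sum_le_sum fun j _ => key j
    _ = _ := by simp [div_eq_mul_inv]

theorem aux_det (d : ℕ) (Λ : Matrix (Fin d) (Fin d) ℝ) (hΛ : Λ.PosDef) (x : Fin d → ℝ)
    (u : ℝ) (hu : u = ∑ ij : Fin d × Fin d, Λ⁻¹ ij.1 ij.2 * (x ij.1 * x ij.2)) :
    0 ≤ u ∧ Real.log (Λ + vecMulVec x x).det - Real.log Λ.det = Real.log (1 + u) := by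
  have hu' : u = x ⬝ᵥ (Λ⁻¹ *ᵥ x) := by
    rw [hu, Fintype.sum_prod_type]
    simp only [dotProduct, mulVec, Finset.mul_sum]
    exact Finset.sum_congr rfl fun i _ => Finset.sum_congr rfl fun j _ => by ring
  have h0 : 0 ≤ u := by
    have := hΛ.inv.posSemidef.dotProduct_mulVec_nonneg x
    rw [hu']; simpa using this
  refine ⟨h0, ?_⟩
  have := det_add_replicateCol_mul_replicateRow (ι := Unit)
    ((isUnit_iff_isUnit_det _).1 hΛ.isUnit) x x
  rw [vecMulVec_eq Unit, this, Real.log_mul hΛ.det_pos.ne']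
  · rw [add_sub_cancel_left, det_unique]
    congr 1
    rw [hu']
    simp [Matrix.mul_assoc, Matrix.mul_apply, dotProduct, mulVec]
  · rw [det_unique]
    have : (1 + replicateRow Unit x * Λ⁻¹ * replicateCol Unit x : Matrix Unit Unit ℝ) default default = 1 + u := by
      rw [hu']
      simp [Matrix.mul_assoc, Matrix.mul_apply, dotProduct, mulVec]
    rw [this]; positivity

theorem aux_sqrt (u w D : ℝ) (hu : 0 ≤ u) (hw : 0 ≤ w) (h : |u - w| ≤ D) :
    |Real.sqrt (Real.log (1 + u)) - Real.sqrt (Real.log (1 + w))| ≤ Real.sqrt D := by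
  have main : ∀ u w : ℝ, 0 ≤ u → 0 ≤ w → |u - w| ≤ D →
      Real.sqrt (Real.log (1 + u)) ≤ Real.sqrt (Real.log (1 + w)) + Real.sqrt D := by
    intro u w hu hw h
    have hD : 0 ≤ D := (abs_nonneg _).trans h
    have h1 : Real.log (1 + u) ≤ Real.log (1 + w) + D := by
      have e : Real.log (1 + u) ≤ Real.log ((1 + w) * Real.exp D) := by
        apply Real.log_le_log (by positivity)
        have := Real.add_one_le_exp D
        have := (abs_le.1 h).2
        nlinarith
      rwa [Real.log_mul (by positivity) (by positivity), Real.log_exp] at e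
    have hl : 0 ≤ Real.log (1 + w) := Real.log_nonneg (by linarith)
    refine (Real.sqrt_le_sqrt h1).trans ?_
    rw [Real.sqrt_le_left (by positivity), add_sq, Real.sq_sqrt hl, Real.sq_sqrt hD]
    have : 0 ≤ Real.sqrt (Real.log (1 + w)) * Real.sqrt D := by positivity
    linarith
  have h1 := main u w hu hw h
  have h2 := main w u hw hu (by rwa [abs_sub_comm])
  rw [abs_le]; constructor <;> linarith

theorem aux_q (d : ℕ) (x : Fin d → ℝ) (hx : Real.sqrt (∑ i, x i ^ 2) ≤ 1)
    (v : EuclideanSpace ℝ (Fin d × Fin d)) :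
    |∑ ij : Fin d × Fin d, v ij * (x ij.1 * x ij.2)| ≤ ‖v‖ := by
  rw [EuclideanSpace.norm_eq]
  apply Real.abs_le_sqrt
  refine (Finset.sum_mul_sq_le_sq_mul_sq _ _ _).trans ?_
  have hx' : ∑ i, x i ^ 2 ≤ 1 := by
    have := (Real.sqrt_le_left (by norm_num)).1 hx
    simpa using this
  have h1 : ∑ ij : Fin d × Fin d, (x ij.1 * x ij.2) ^ 2 = (∑ i, x i ^ 2) * ∑ i, x i ^ 2 := by
    rw [Finset.sum_mul_sum, Fintype.sum_prod_type]
    simp [mul_pow]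
  have h5 : 0 ≤ ∑ i, x i ^ 2 := Finset.sum_nonneg fun i _ => sq_nonneg _
  rw [h1]
  have h2 : (∑ i, x i ^ 2) * ∑ i, x i ^ 2 ≤ 1 := mul_le_one₀ hx' h5 hx'
  have h3 : 0 ≤ ∑ ij, v ij ^ 2 := Finset.sum_nonneg fun i _ => sq_nonneg _
  simp only [Real.norm_eq_abs, sq_abs]
  exact mul_le_of_le_one_right h3 h2

theorem aux_dot (d : ℕ) (x : Fin d → ℝ) (hx : Real.sqrt (∑ i, x i ^ 2) ≤ 1)
    (v : EuclideanSpace ℝ (Fin d)) : |x ⬝ᵥ (fun i => v i)| ≤ ‖v‖ := by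
  rw [EuclideanSpace.norm_eq]
  apply Real.abs_le_sqrt
  refine (Finset.sum_mul_sq_le_sq_mul_sq _ _ _).trans ?_
  have hx' : ∑ i, x i ^ 2 ≤ 1 := by
    have := (Real.sqrt_le_left (by norm_num)).1 hx
    simpa using this
  have h3 : 0 ≤ ∑ ij, v ij ^ 2 := Finset.sum_nonneg fun i _ => sq_nonneg _
  simp only [Real.norm_eq_abs, sq_abs]
  exact mul_le_of_le_one_left h3 hx'

end helpers

/-- covering number of the optimistic action-value class.
For every `ε > 0` there is a finite `ε`-net `𝒩` of the class of functions
`Q(x,a) = min{ ψ(x,a)ᵀω + √2 β (log det(Λ + ψψᵀ) − log det Λ)^{1/2}, H−h }`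
(ranging over `‖ω‖₂ ≤ L` and symmetric positive definite `Λ ⪰ λI`) with
`log |𝒩| ≤ d log(1 + 4L/ε) + d² log(1 + 16 B² √d / (ε² λ))`. -/
theorem stmt_8 (d : ℕ) (hd : 0 < d)
    {X A : Type*} [Nonempty X] [Nonempty A]
    (ψ : X × A → Fin d → ℝ) (hψ : ∀ p, Real.sqrt (∑ i, ψ p i ^ 2) ≤ 1)
    (lam L B β H h : ℝ) (hlam : 0 < lam) (hL : 0 < L) (hB : 0 ≤ B)
    (hβ : β ∈ Set.Icc 0 B) (hHh : 0 ≤ H - h) :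
    ∀ ε : ℝ, 0 < ε →
      ∃ 𝒩 : Finset (X × A → ℝ),
        (∀ ω : Fin d → ℝ, ∀ Λ : Matrix (Fin d) (Fin d) ℝ,
            Real.sqrt (∑ i, ω i ^ 2) ≤ L → Λ.IsSymm → Λ.PosDef →
            (Λ - lam • (1 : Matrix (Fin d) (Fin d) ℝ)).PosSemidef →
            ∃ Qt ∈ 𝒩, ∀ p : X × A,
              |min (ψ p ⬝ᵥ ω + Real.sqrt 2 * β *
                    Real.sqrt
                      (Real.log (Λ + vecMulVec (ψ p) (ψ p)).det -
                        Real.log Λ.det))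
                  (H - h) - Qt p| ≤ ε) ∧
        Real.log 𝒩.card ≤
          d * Real.log (1 + 4 * L / ε) +
            d ^ 2 * Real.log (1 + 16 * B ^ 2 * Real.sqrt d / (ε ^ 2 * lam)) := by
  classical
  intro ε hε
  obtain ⟨hβ0, hβB⟩ := hβ
  obtain ⟨N1, -, hN1, hc1⟩ := aux_net (E := EuclideanSpace ℝ (Fin d)) L (ε / 2) hL.le
    (by positivity) {w | ‖w‖ ≤ L} (fun c hc => hc)
  let q : EuclideanSpace ℝ (Fin d × Fin d) → (Fin d → ℝ) → ℝ := fun v x =>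
    ∑ ij : Fin d × Fin d, v ij * (x ij.1 * x ij.2)
  let S : Set (EuclideanSpace ℝ (Fin d × Fin d)) :=
    {v | ‖v‖ ≤ Real.sqrt d / lam ∧ ∀ x, 0 ≤ q v x}
  obtain ⟨N2, hS2, hN2, hc2⟩ : ∃ N : Finset (EuclideanSpace ℝ (Fin d × Fin d)),
      (∀ v ∈ N, v ∈ S) ∧
      (∀ v ∈ S, ∃ w ∈ N, Real.sqrt 2 * β * Real.sqrt ‖v - w‖ ≤ ε / 2) ∧
      (N.card : ℝ) ≤ (1 + 16 * B ^ 2 * Real.sqrt d / (ε ^ 2 * lam)) ^ (d ^ 2) := by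
    rcases hB.eq_or_lt with h0 | hBpos
    · have hβ' : β = 0 := by linarith
      refine ⟨{0}, ?_, ?_, ?_⟩
      · intro v hv
        rw [Finset.mem_singleton.1 hv]
        refine ⟨?_, fun x => ?_⟩
        · rw [norm_zero]; positivity
        · simp [q]
      · intro v hv
        refine ⟨0, by simp, ?_⟩
        rw [hβ']; simp; positivity
      · simp [← h0]
    · obtain ⟨N, a1, a2, a3⟩ := aux_net (E := EuclideanSpace ℝ (Fin d × Fin d))
        (Real.sqrt d / lam) (ε ^ 2 / (8 * B ^ 2)) (by positivity) (by positivity) S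
        (fun c hc => hc.1)
      refine ⟨N, a1, ?_, ?_⟩
      · intro v hv
        obtain ⟨w, hw, hvw⟩ := a2 v hv
        refine ⟨w, hw, ?_⟩
        apply le_of_sq_le_sq _ (by positivity)
        rw [mul_pow, mul_pow, Real.sq_sqrt (by norm_num), Real.sq_sqrt (norm_nonneg _)]
        rw [le_div_iff₀ (by positivity)] at hvw
        have : β ^ 2 ≤ B ^ 2 := pow_le_pow_left₀ hβ0 hβB 2
        nlinarith [mul_le_mul_of_nonneg_right this (norm_nonneg (v - w))]
      · convert a3 using 1
        rw [finrank_euclideanSpace, Fintype.card_prod, Fintype.card_fin, pow_two d]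
        congr 2
        field_simp
        ring
  let F : EuclideanSpace ℝ (Fin d) × EuclideanSpace ℝ (Fin d × Fin d) → X × A → ℝ :=
    fun z p => min (ψ p ⬝ᵥ (fun i => z.1 i) +
      Real.sqrt 2 * β * Real.sqrt (Real.log (1 + q z.2 (ψ p)))) (H - h)
  refine ⟨(N1 ×ˢ N2).image F, ?_, ?_⟩
  · intro ω Λ hω _ hΛ hΛl
    obtain ⟨w, hw, hwd⟩ := hN1 (WithLp.toLp 2 ω) (by
      change ‖_‖ ≤ L
      rw [EuclideanSpace.norm_eq]; simpa using hω)
    let V : EuclideanSpace ℝ (Fin d × Fin d) := WithLp.toLp 2 fun ij => Λ⁻¹ ij.1 ij.2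
    have hq : ∀ x, 0 ≤ q V x ∧
        Real.log (Λ + vecMulVec x x).det - Real.log Λ.det = Real.log (1 + q V x) :=
      fun x => aux_det d Λ hΛ x (q V x) rfl
    have hVS : V ∈ S := by
      refine ⟨?_, fun x => (hq x).1⟩
      rw [EuclideanSpace.norm_eq]
      rw [Real.sqrt_le_left (by positivity), div_pow, Real.sq_sqrt (by positivity)]
      simpa [V] using aux_inv d lam hlam Λ hΛ hΛl
    obtain ⟨W, hW, hWd⟩ := hN2 V hVS
    refine ⟨F (w, W), Finset.mem_image_of_mem _ (Finset.mk_mem_product hw hW), fun p => ?_⟩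
    rw [(hq _).2]
    refine (abs_min_sub_min_le_max _ _ _ _).trans ?_
    rw [sub_self, abs_zero, max_le_iff]
    refine ⟨?_, hε.le⟩
    have b1 : |ψ p ⬝ᵥ ω - ψ p ⬝ᵥ (fun i => w i)| ≤ ε / 2 := by
      refine le_trans ?_ hwd
      rw [← dotProduct_sub]
      exact aux_dot d (ψ p) (hψ p) (WithLp.toLp 2 ω - w)
    have b2 : |q V (ψ p) - q W (ψ p)| ≤ ‖V - W‖ := by
      have := aux_q d (ψ p) (hψ p) (V - W)
      simpa [q, sub_mul, Finset.sum_sub_distrib] using this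
    have b3 := aux_sqrt _ _ _ (hq (ψ p)).1 ((hS2 W hW).2 (ψ p)) b2
    have b4 : |Real.sqrt 2 * β * Real.sqrt (Real.log (1 + q V (ψ p))) -
        Real.sqrt 2 * β * Real.sqrt (Real.log (1 + q W (ψ p)))| ≤ ε / 2 := by
      refine le_trans ?_ hWd
      rw [← mul_sub, abs_mul, abs_of_nonneg (a := Real.sqrt 2 * β) (by positivity)]
      exact mul_le_mul_of_nonneg_left b3 (by positivity)
    have b5 := (abs_le.1 b1)
    have b6 := (abs_le.1 b4)
    rw [abs_le]
    constructor <;> simp only <;> linarith [b5.1, b5.2, b6.1, b6.2]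
  · have g1 : 1 ≤ 1 + 4 * L / ε := by
      have : 0 ≤ 4 * L / ε := by positivity
      linarith
    have g2 : 1 ≤ 1 + 16 * B ^ 2 * Real.sqrt d / (ε ^ 2 * lam) := by
      have : 0 ≤ 16 * B ^ 2 * Real.sqrt d / (ε ^ 2 * lam) := by positivity
      linarith
    rcases Nat.eq_zero_or_pos ((N1 ×ˢ N2).image F).card with h0 | hpos
    · rw [h0]
      have := Real.log_nonneg g1
      have := Real.log_nonneg g2
      simp only [Nat.cast_zero, Real.log_zero]
      positivity
    · have hc1' : (N1.card : ℝ) ≤ (1 + 4 * L / ε) ^ d := by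
        rw [finrank_euclideanSpace, Fintype.card_fin] at hc1
        convert hc1 using 3
        field_simp
        ring
      have hcard : (((N1 ×ˢ N2).image F).card : ℝ) ≤ (1 + 4 * L / ε) ^ d *
          (1 + 16 * B ^ 2 * Real.sqrt d / (ε ^ 2 * lam)) ^ (d ^ 2) := by
        calc (((N1 ×ˢ N2).image F).card : ℝ) ≤ (N1.card : ℝ) * N2.card := by
              have := (Finset.card_image_le (s := N1 ×ˢ N2) (f := F))
              rw [Finset.card_product] at this
              exact_mod_cast this
          _ ≤ _ := mul_le_mul hc1' hc2 (by positivity) (by positivity)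
      have := Real.log_le_log (by exact_mod_cast hpos) hcard
      rw [Real.log_mul (by positivity) (by positivity), Real.log_pow, Real.log_pow] at this
      exact_mod_cast this
end

section
/- Fix positive integers d and a nonempty set X, a nonempty set A, a function ψ : X × A → ℝ^d with ‖ψ(x,a)‖₂ ≤ 1 for all (x,a), and constants λ > 0, B ≥ 0, a fixed β ∈ [0, B], and reals H, h with H − h ≥ 0. For ω ∈ ℝ^d and a symmetric positive definite Λ ∈ ℝ^{d×d} with Λ ⪰ λI, define V_{ω,Λ}(x) = min{ sup_{a∈A} [ ψ(x,a)ᵀ ω + √2 β · (log det(Λ + ψ(x,a) ψ(x,a)ᵀ) − log det(Λ))^{1/2} ], H − h }. Then for any two parameter pairs (ω₁, Λ₁) and (ω₂, Λ₂) as above, sup_{x∈X} |V_{ω₁,Λ₁}(x) − V_{ω₂,Λ₂}(x)| ≤ ‖ω₁ − ω₂‖₂ + ‖2β² Λ₁⁻¹ − 2β² Λ₂⁻¹‖_F^{1/2}, where ‖·‖_F denotes the Frobenius norm. -/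
open Matrix

theorem aux_cs {ι : Type*} [Fintype ι] (u v : ι → ℝ) :
    |∑ i, u i * v i| ≤ Real.sqrt (∑ i, u i ^ 2) * Real.sqrt (∑ i, v i ^ 2) := by
  rw [abs_le]
  constructor
  · have := Real.sum_mul_le_sqrt_mul_sqrt Finset.univ (fun i => - u i) v
    simp only [neg_mul, Finset.sum_neg_distrib, neg_sq] at this
    linarith
  · exact Real.sum_mul_le_sqrt_mul_sqrt Finset.univ u v

theorem aux_dot_s13 {d : ℕ} (p w : Fin d → ℝ) (hp : Real.sqrt (∑ i, p i ^ 2) ≤ 1) :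
    |p ⬝ᵥ w| ≤ Real.sqrt (∑ i, w i ^ 2) := by
  refine (aux_cs p w).trans ?_
  exact mul_le_of_le_one_left (Real.sqrt_nonneg _) hp

theorem aux_quad {d : ℕ} (p : Fin d → ℝ) (M : Matrix (Fin d) (Fin d) ℝ)
    (hp : Real.sqrt (∑ i, p i ^ 2) ≤ 1) :
    |p ⬝ᵥ (M *ᵥ p)| ≤ Real.sqrt (∑ i, ∑ j, M i j ^ 2) := by
  refine (aux_dot_s13 p _ hp).trans ?_
  apply Real.sqrt_le_sqrt
  apply Finset.sum_le_sum
  intro i _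
  have h1 := aux_dot_s13 p (M i) hp
  have h0 : 0 ≤ ∑ j, M i j ^ 2 := Finset.sum_nonneg fun j _ => sq_nonneg _
  have h2 : (M *ᵥ p) i = p ⬝ᵥ M i := dotProduct_comm _ _
  rw [h2, ← Real.sq_sqrt h0]
  exact sq_le_sq' (by linarith [neg_abs_le (p ⬝ᵥ M i)]) (by linarith [le_abs_self (p ⬝ᵥ M i)])

theorem aux_q_nonneg {d : ℕ} (p : Fin d → ℝ) (L : Matrix (Fin d) (Fin d) ℝ) (hL : L.PosDef) :
    0 ≤ p ⬝ᵥ (L⁻¹ *ᵥ p) := by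
  simpa using hL.inv.posSemidef.dotProduct_mulVec_nonneg p

theorem aux_logdet {d : ℕ} (p : Fin d → ℝ) (L : Matrix (Fin d) (Fin d) ℝ) (hL : L.PosDef) :
    Real.log (L + vecMulVec p p).det - Real.log L.det =
      Real.log (1 + p ⬝ᵥ (L⁻¹ *ᵥ p)) := by
  have hdet := hL.det_pos
  have hq := aux_q_nonneg p L hL
  have h : (L + vecMulVec p p).det = L.det * (1 + p ⬝ᵥ (L⁻¹ *ᵥ p)) := by
    rw [vecMulVec_eq Unit, Matrix.det_add_replicateCol_mul_replicateRow
      (isUnit_iff_ne_zero.mpr hdet.ne'), Matrix.mul_assoc, det_unique (n := Unit)]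
    rfl
  rw [h, Real.log_mul hdet.ne' (by positivity)]
  ring

theorem aux_sqrtlog (q r : ℝ) (hq : 0 ≤ q) (hr : 0 ≤ r) :
    Real.sqrt (Real.log (1 + q)) ≤ Real.sqrt (Real.log (1 + r)) + Real.sqrt |q - r| := by
  have hl : 0 ≤ Real.log (1 + r) := Real.log_nonneg (by linarith)
  have h1 : Real.log (1 + q) ≤ Real.log (1 + r) + |q - r| := by
    have h2 := Real.log_le_sub_one_of_pos (x := (1 + q) / (1 + r)) (by positivity)
    rw [Real.log_div (by positivity) (by positivity)] at h2
    have h3 : (1 + q) / (1 + r) - 1 ≤ |q - r| := by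
      rw [sub_le_iff_le_add, div_le_iff₀ (by positivity)]
      nlinarith [le_abs_self (q - r), mul_nonneg (abs_nonneg (q - r)) hr]
    linarith
  rw [Real.sqrt_le_left (by positivity)]
  nlinarith [Real.sq_sqrt hl, Real.sq_sqrt (abs_nonneg (q - r)),
    mul_nonneg (Real.sqrt_nonneg (Real.log (1 + r))) (Real.sqrt_nonneg |q - r|)]

theorem aux_point {d : ℕ} (p ω₁ ω₂ : Fin d → ℝ) (hp : Real.sqrt (∑ i, p i ^ 2) ≤ 1)
    (β : ℝ) (hβ : 0 ≤ β) (Λ₁ Λ₂ : Matrix (Fin d) (Fin d) ℝ) (h1 : Λ₁.PosDef) (h2 : Λ₂.PosDef) :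
    p ⬝ᵥ ω₁ + Real.sqrt 2 * β *
        Real.sqrt (Real.log (Λ₁ + vecMulVec p p).det - Real.log Λ₁.det) ≤
      p ⬝ᵥ ω₂ + Real.sqrt 2 * β *
        Real.sqrt (Real.log (Λ₂ + vecMulVec p p).det - Real.log Λ₂.det) +
      (Real.sqrt (∑ i, (ω₁ i - ω₂ i) ^ 2) +
        Real.sqrt (Real.sqrt (∑ i, ∑ j,
          (((2 * β ^ 2) • Λ₁⁻¹ - (2 * β ^ 2) • Λ₂⁻¹) i j) ^ 2))) := by
  rw [aux_logdet p _ h1, aux_logdet p _ h2]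
  have e1 := aux_sqrtlog _ _ (aux_q_nonneg p _ h1) (aux_q_nonneg p _ h2)
  have e2 : p ⬝ᵥ ω₁ - p ⬝ᵥ ω₂ ≤ Real.sqrt (∑ i, (ω₁ i - ω₂ i) ^ 2) := by
    rw [← dotProduct_sub]
    exact (le_abs_self _).trans (aux_dot_s13 p (ω₁ - ω₂) hp)
  have e3 := aux_quad p ((2 * β ^ 2) • Λ₁⁻¹ - (2 * β ^ 2) • Λ₂⁻¹) hp
  have e4 : p ⬝ᵥ (((2 * β ^ 2) • Λ₁⁻¹ - (2 * β ^ 2) • Λ₂⁻¹) *ᵥ p) =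
      (2 * β ^ 2) * (p ⬝ᵥ (Λ₁⁻¹ *ᵥ p) - p ⬝ᵥ (Λ₂⁻¹ *ᵥ p)) := by
    rw [sub_mulVec, smul_mulVec, smul_mulVec, dotProduct_sub, dotProduct_smul, dotProduct_smul]
    simp only [smul_eq_mul]
    ring
  rw [e4, abs_mul, abs_of_nonneg (by positivity : 0 ≤ 2 * β ^ 2)] at e3
  have e5 := Real.sqrt_le_sqrt e3
  rw [Real.sqrt_mul (by positivity), Real.sqrt_mul (by norm_num), Real.sqrt_sq hβ] at e5
  have e6 := mul_le_mul_of_nonneg_left e1 (by positivity : 0 ≤ Real.sqrt 2 * β)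
  rw [mul_add] at e6
  linarith

theorem aux_bdd {d : ℕ} {A : Type*} (p : A → Fin d → ℝ) (ω : Fin d → ℝ)
    (hp : ∀ a, Real.sqrt (∑ i, p a i ^ 2) ≤ 1)
    (β : ℝ) (hβ : 0 ≤ β) (L : Matrix (Fin d) (Fin d) ℝ) (hL : L.PosDef) :
    BddAbove (Set.range fun a => p a ⬝ᵥ ω + Real.sqrt 2 * β *
        Real.sqrt (Real.log (L + vecMulVec (p a) (p a)).det - Real.log L.det)) := by
  refine ⟨Real.sqrt (∑ i, ω i ^ 2) + Real.sqrt 2 * β *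
    Real.sqrt (Real.sqrt (∑ i, ∑ j, L⁻¹ i j ^ 2)), ?_⟩
  rintro _ ⟨a, rfl⟩
  simp only
  rw [aux_logdet _ _ hL]
  have hq := aux_q_nonneg (p a) _ hL
  have h2 := Real.log_le_sub_one_of_pos (x := 1 + p a ⬝ᵥ (L⁻¹ *ᵥ p a)) (by positivity)
  have h3 := (le_abs_self _).trans (aux_quad (p a) L⁻¹ (hp a))
  have h4 := (le_abs_self _).trans (aux_dot_s13 (p a) ω (hp a))
  gcongr
  linarith

theorem aux_sup {A : Type*} [Nonempty A] (f g : A → ℝ) (c m : ℝ) (hc : 0 ≤ c)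
    (hg : BddAbove (Set.range g)) (h : ∀ a, f a ≤ g a + c) :
    min (⨆ a, f a) m - min (⨆ a, g a) m ≤ c := by
  have h1 : (⨆ a, f a) ≤ (⨆ a, g a) + c :=
    ciSup_le fun a => (h a).trans (by linarith [le_ciSup hg a])
  rw [sub_le_iff_le_add, ← min_add_add_left]
  exact le_min ((min_le_left _ _).trans (by linarith)) ((min_le_right _ _).trans (by linarith))

/-- sup-norm Lipschitz continuity of the truncated optimistic
value function in its parameters. For
`V_{ω,Λ}(x) = min{ sup_a [ψ(x,a)ᵀω + √2 β (log det(Λ + ψψᵀ) − log det Λ)^{1/2}], H−h }`,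
any two parameter pairs `(ω₁,Λ₁)`, `(ω₂,Λ₂)` (with `Λᵢ` symmetric positive
definite and `Λᵢ ⪰ λI`) satisfy
`sup_x |V_{ω₁,Λ₁}(x) − V_{ω₂,Λ₂}(x)| ≤ ‖ω₁ − ω₂‖₂ + ‖2β²Λ₁⁻¹ − 2β²Λ₂⁻¹‖_F^{1/2}`. -/
theorem stmt_13 (d : ℕ) (hd : 0 < d)
    {X A : Type*} [Nonempty X] [Nonempty A]
    (ψ : X × A → Fin d → ℝ) (hψ : ∀ p, Real.sqrt (∑ i, ψ p i ^ 2) ≤ 1)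
    (lam B β H h : ℝ) (hlam : 0 < lam) (hB : 0 ≤ B)
    (hβ : β ∈ Set.Icc 0 B) (hHh : 0 ≤ H - h)
    (ω₁ ω₂ : Fin d → ℝ) (Λ₁ Λ₂ : Matrix (Fin d) (Fin d) ℝ)
    (h1s : Λ₁.IsSymm) (h1 : Λ₁.PosDef)
    (h1lam : (Λ₁ - lam • (1 : Matrix (Fin d) (Fin d) ℝ)).PosSemidef)
    (h2s : Λ₂.IsSymm) (h2 : Λ₂.PosDef)
    (h2lam : (Λ₂ - lam • (1 : Matrix (Fin d) (Fin d) ℝ)).PosSemidef) :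
    ∀ x : X,
      |min (⨆ a : A,
            (ψ (x, a) ⬝ᵥ ω₁ + Real.sqrt 2 * β *
              Real.sqrt
                (Real.log (Λ₁ + vecMulVec (ψ (x, a)) (ψ (x, a))).det -
                  Real.log Λ₁.det))) (H - h) -
        min (⨆ a : A,
            (ψ (x, a) ⬝ᵥ ω₂ + Real.sqrt 2 * β *
              Real.sqrt
                (Real.log (Λ₂ + vecMulVec (ψ (x, a)) (ψ (x, a))).det -
                  Real.log Λ₂.det))) (H - h)| ≤
      Real.sqrt (∑ i, (ω₁ i - ω₂ i) ^ 2) +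
        Real.sqrt (Real.sqrt (∑ i, ∑ j,
          (((2 * β ^ 2) • Λ₁⁻¹ - (2 * β ^ 2) • Λ₂⁻¹) i j) ^ 2)) := by
  intro x
  have hb := hβ.1
  rw [abs_le']
  constructor
  · exact aux_sup _ _ _ _ (by positivity)
      (aux_bdd (fun a => ψ (x, a)) ω₂ (fun a => hψ _) β hb Λ₂ h2)
      (fun a => aux_point (ψ (x, a)) ω₁ ω₂ (hψ _) β hb Λ₁ Λ₂ h1 h2)
  · rw [neg_sub]
    refine aux_sup _ _ _ _ (by positivity)
      (aux_bdd (fun a => ψ (x, a)) ω₁ (fun a => hψ _) β hb Λ₁ h1)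
      (fun a => ?_)
    have := aux_point (ψ (x, a)) ω₂ ω₁ (hψ _) β hb Λ₂ Λ₁ h2 h1
    have e1 : ∀ i, (ω₂ i - ω₁ i) ^ 2 = (ω₁ i - ω₂ i) ^ 2 := fun i => by ring
    have e2 : ∀ i j, (((2 * β ^ 2) • Λ₂⁻¹ - (2 * β ^ 2) • Λ₁⁻¹) i j) ^ 2 =
        (((2 * β ^ 2) • Λ₁⁻¹ - (2 * β ^ 2) • Λ₂⁻¹) i j) ^ 2 := fun i j => by
      simp only [Matrix.sub_apply]; ring
    simp only [e1, e2] at this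
    exact this
end
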